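/- arXiv:1710.06030 — 2 statements merged into one kernel-verified Lean document; each statement's English description precedes it below -/
import Mathlib

section
/- Let n > d ≥ 1, let X ∈ ℝ^{n×d} be a random matrix with i.i.d. N(0,1) entries, and let y = ε where ε ∈ ℝⁿ has i.i.d. N(0,σ²) entries independent of X (i.e., β* = 0 and Π* = I_n). Let (Π̂, β̂) be a minimizer of ‖ΠXβ − y‖₂² over all n×n permutation matrices Π and all β ∈ ℝ^d. Then there exist absolute constants c, C > 0 such that with probability at least 1 − C·exp(−c·n), one has ‖β̂‖₂² ≥ (n/(2n+d))·σ²/(32π²). -/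
open MeasureTheory ProbabilityTheory Matrix

noncomputable section

/-- Euclidean (ℓ₂) norm on `Fin n → ℝ`. -/
def l2 {n : ℕ} (v : Fin n → ℝ) : ℝ := Real.sqrt (∑ i, v i ^ 2)

/-- Action of (the matrix of) a permutation on a vector. -/
def permVec {n : ℕ} (σ : Equiv.Perm (Fin n)) (v : Fin n → ℝ) : Fin n → ℝ := fun i => v (σ i)

abbrev stdGaussian : Measure ℝ := gaussianReal 0 1

/-- design distribution: iid N(0,1) entries -/
abbrev μX (n d : ℕ) : Measure (Fin n → Fin d → ℝ) := Measure.pi fun _ => Measure.pi fun _ => stdGaussian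

/-- noise distribution: iid N(0, σ²) entries -/
abbrev μNoise (n : ℕ) (σ : ℝ) : Measure (Fin n → ℝ) :=
  Measure.pi fun _ => gaussianReal 0 ⟨σ ^ 2, sq_nonneg σ⟩

/-- joint distribution of (X, ε), with X and ε independent -/
abbrev μData (n d : ℕ) (σ : ℝ) : Measure ((Fin n → Fin d → ℝ) × (Fin n → ℝ)) :=
  (μX n d).prod (μNoise n σ)

abbrev Ω (n d : ℕ) := (Fin n → Fin d → ℝ) × (Fin n → ℝ)

abbrev desX {n d : ℕ} (ω : Ω n d) : Matrix (Fin n) (Fin d) ℝ := Matrix.of ω.1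

theorem aux_exp_neg_le {y : ℝ} (hy : 0 ≤ y) : Real.exp (-y) ≤ 1 - y + y ^ 2 / 2 := by
  have h := Real.quadratic_le_exp_of_nonneg hy
  have h1 : Real.exp (-y) * Real.exp y = 1 := by rw [← Real.exp_add]; simp
  have h2 : 0 < Real.exp (-y) := Real.exp_pos _
  have h3 : Real.exp (-y) * (1 + y + y ^ 2 / 2) ≤ 1 := by
    calc _ ≤ Real.exp (-y) * Real.exp y := by gcongr
      _ = 1 := h1
  have h4 : 0 < 1 + y + y ^ 2 / 2 := by positivity
  by_contra hc
  push Not at hc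
  have : (1 - y + y ^ 2 / 2) * (1 + y + y ^ 2 / 2) < 1 := lt_of_lt_of_le (by gcongr) h3
  nlinarith [sq_nonneg (y ^ 2)]

theorem aux_lintegral_pi_prod {ι : Type*} [Fintype ι] {E : Type*} [MeasurableSpace E]
    (ν : ι → Measure E) [∀ i, IsProbabilityMeasure (ν i)] (f : ι → E → ENNReal)
    (hf : ∀ i, Measurable (f i)) :
    ∫⁻ x, ∏ i, f i (x i) ∂(Measure.pi ν) = ∏ i, ∫⁻ x, f i x ∂(ν i) := by
  have hI : iIndepFun (fun i (x : ι → E) => f i (x i)) (Measure.pi ν) :=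
    iIndepFun_pi (fun i => (hf i).aemeasurable)
  rw [lintegral_prod_eq_prod_lintegral_of_indepFun Finset.univ (fun i (x : ι → E) => f i (x i))
    hI (fun i => (hf i).comp (measurable_pi_apply i))]
  refine Finset.prod_congr rfl fun i _ => ?_
  exact (measurePreserving_eval ν i).lintegral_comp (hf i)

/-- Chernoff bound. -/
theorem aux_chernoff {E : Type*} [MeasurableSpace E] (ν : Measure E) [IsProbabilityMeasure ν]
    (f : E → ℝ) (hf : Measurable f) (n : ℕ) (c : ℝ)
    (h : ∫⁻ x, ENNReal.ofReal (Real.exp (f x)) ∂ν ≤ ENNReal.ofReal (Real.exp (-c))) :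
    (Measure.pi fun _ : Fin n => ν) {x | 0 ≤ ∑ i, f (x i)} ≤ ENNReal.ofReal (Real.exp (-c * n)) := by
  have hF : Measurable fun x : Fin n → E => ∏ i, ENNReal.ofReal (Real.exp (f (x i))) := by
    fun_prop
  have h1 := mul_meas_ge_le_lintegral (μ := Measure.pi fun _ : Fin n => ν) hF 1
  rw [one_mul, aux_lintegral_pi_prod (fun _ : Fin n => ν) (fun _ x => ENNReal.ofReal (Real.exp (f x)))
    (fun _ => by fun_prop)] at h1
  calc _ ≤ _ := measure_mono ?_
    _ ≤ _ := h1
    _ ≤ ∏ i : Fin n, ENNReal.ofReal (Real.exp (-c)) := Finset.prod_le_prod' fun i _ => h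
    _ = _ := by
      rw [Finset.prod_const, ← ENNReal.ofReal_pow (Real.exp_pos _).le, ← Real.exp_nat_mul]
      simp [mul_comm]
  intro x hx
  simp only [Set.mem_ofPred_eq] at hx ⊢
  rw [← ENNReal.ofReal_prod_of_nonneg (fun i _ => (Real.exp_pos _).le), ← Real.exp_sum]
  simpa using hx

theorem aux_mgf (t : ℝ) :
    ∫⁻ x, ENNReal.ofReal (Real.exp (t * x)) ∂(gaussianReal 0 1)
      = ENNReal.ofReal (Real.exp (t ^ 2 / 2)) := by
  rw [← ofReal_integral_eq_lintegral_ofReal (integrable_exp_mul_gaussianReal t)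
    (Filter.Eventually.of_forall fun x => (Real.exp_pos _).le)]
  have := congrFun (mgf_id_gaussianReal (μ := 0) (v := 1)) t
  simp only [mgf, id] at this
  rw [this]; simp

theorem aux_sq (a : ℝ) (ha : a < 1 / 2) :
    ∫⁻ x, ENNReal.ofReal (Real.exp (a * x ^ 2)) ∂(gaussianReal 0 1)
      = ENNReal.ofReal (Real.sqrt (1 - 2 * a))⁻¹ := by
  rw [gaussianReal_of_var_ne_zero _ one_ne_zero,
    lintegral_withDensity_eq_lintegral_mul _ (measurable_gaussianPDF 0 1) (by fun_prop)]
  have h1 : ∀ x : ℝ, (gaussianPDF 0 1 * fun x => ENNReal.ofReal (Real.exp (a * x ^ 2))) x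
      = ENNReal.ofReal ((Real.sqrt (2 * Real.pi))⁻¹ * Real.exp (-(1 / 2 - a) * x ^ 2)) := by
    intro x
    simp only [Pi.mul_apply, gaussianPDF, gaussianPDFReal]
    rw [← ENNReal.ofReal_mul (by positivity)]
    congr 1
    rw [mul_assoc, ← Real.exp_add]
    simp only [NNReal.coe_one, mul_one, sub_zero]
    congr 2
    ring
  simp_rw [h1]
  rw [← ofReal_integral_eq_lintegral_ofReal
    ((integrable_exp_neg_mul_sq (by linarith)).const_mul _)
    (Filter.Eventually.of_forall fun x => by positivity), integral_const_mul, integral_gaussian]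
  congr 1
  rw [← Real.sqrt_inv, ← Real.sqrt_mul (by positivity), ← Real.sqrt_inv]
  congr 1
  have : 1 - 2 * a ≠ 0 := by linarith
  have : 1 / 2 - a ≠ 0 := by linarith
  have := Real.pi_pos.ne'
  field_simp

theorem aux_neg (f : ℝ → ENNReal) (hf : Measurable f) :
    ∫⁻ x, f (-x) ∂(gaussianReal 0 1) = ∫⁻ x, f x ∂(gaussianReal 0 1) := by
  have h : (gaussianReal 0 1).map (fun x => -x) = gaussianReal 0 1 := by
    simpa using gaussianReal_map_neg (μ := 0) (v := 1)
  conv_rhs => rw [← h]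
  rw [lintegral_map hf measurable_neg]

theorem aux_Icc : (gaussianReal 0 1) (Set.Icc (-(3 / 4) : ℝ) (3 / 4)) ≤ ENNReal.ofReal (55 / 100) := by
  rw [gaussianReal_apply_eq_integral _ one_ne_zero]
  apply ENNReal.ofReal_le_ofReal
  have hs : (Real.sqrt (2 * Real.pi))⁻¹ ≤ 4 / 10 := by
    have : (25 / 10 : ℝ) ≤ Real.sqrt (2 * Real.pi) := by
      apply Real.le_sqrt_of_sq_le
      have := Real.pi_gt_d2
      norm_num
      linarith
    calc _ ≤ (25 / 10 : ℝ)⁻¹ := by gcongr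
      _ = _ := by norm_num
  calc _ ≤ ∫ x in Set.Icc (-(3 / 4) : ℝ) (3 / 4), 4 / 10 * (1 - x ^ 2 / 2 + x ^ 4 / 8) := by
        apply setIntegral_mono_on
        · exact (integrable_gaussianPDFReal 0 1).integrableOn
        · exact Continuous.integrableOn_Icc (by fun_prop)
        · exact measurableSet_Icc
        · intro x _
          simp only [gaussianPDFReal]
          have h1 := aux_exp_neg_le (y := x ^ 2 / 2) (by positivity)
          have h2 : Real.exp (-(x - 0) ^ 2 / (2 * ((1 : NNReal) : ℝ))) ≤ 1 - x ^ 2 / 2 + x ^ 4 / 8 := by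
            convert! h1 using 1
            · congr 1; simp; ring
            · ring
          have h3 : (Real.sqrt (2 * Real.pi * ((1 : NNReal) : ℝ)))⁻¹ ≤ 4 / 10 := by simpa using hs
          exact mul_le_mul h3 h2 (Real.exp_pos _).le (by norm_num)
    _ = ∫ x in (-(3 / 4) : ℝ)..(3 / 4), 4 / 10 * (1 - x ^ 2 / 2 + x ^ 4 / 8) := by
        rw [intervalIntegral.integral_of_le (by norm_num), integral_Icc_eq_integral_Ioc]
    _ ≤ 55 / 100 := by
        rw [intervalIntegral.integral_const_mul, intervalIntegral.integral_add,
          intervalIntegral.integral_sub]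
        · simp [intervalIntegral.integral_div, integral_pow]
          norm_num
        all_goals exact Continuous.intervalIntegrable (by fun_prop) _ _

theorem aux_tail : ENNReal.ofReal (225 / 1000) ≤ (gaussianReal 0 1) (Set.Ici (3 / 4 : ℝ)) := by
  set p := (gaussianReal 0 1) (Set.Ici (3 / 4 : ℝ)) with hp
  have h : (gaussianReal 0 1).map (fun x => -x) = gaussianReal 0 1 := by
    simpa using gaussianReal_map_neg (μ := 0) (v := 1)
  have h2 : (gaussianReal 0 1) (Set.Iic (-(3 / 4) : ℝ)) = p := by
    rw [hp]
    conv_rhs => rw [← h, Measure.map_apply measurable_neg measurableSet_Ici]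
    congr 1
    ext x; simp
  have h3 : (1 : ENNReal) ≤ p + p + ENNReal.ofReal (55 / 100) := by
    calc (1 : ENNReal) = (gaussianReal 0 1) Set.univ := by simp
      _ ≤ (gaussianReal 0 1) ((Set.Ici (3 / 4 : ℝ) ∪ Set.Iic (-(3 / 4) : ℝ)) ∪
          Set.Icc (-(3 / 4) : ℝ) (3 / 4)) := by
        apply measure_mono
        intro x _
        simp only [Set.mem_union, Set.mem_Ici, Set.mem_Iic, Set.mem_Icc]
        by_cases h1 : 3 / 4 ≤ x
        · tauto
        · by_cases h2 : x ≤ -(3 / 4)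
          · tauto
          · right; constructor <;> linarith
      _ ≤ _ := (measure_union_le _ _).trans (add_le_add (measure_union_le _ _) le_rfl)
      _ ≤ _ := by rw [h2]; gcongr; exact aux_Icc
  have hpt : p ≠ ⊤ := measure_ne_top _ _
  clear_value p
  lift p to NNReal using hpt
  have h4 := ENNReal.toReal_mono (by finiteness) h3
  rw [ENNReal.toReal_add (by finiteness) (by finiteness), ENNReal.toReal_add (by finiteness) (by finiteness),
    ENNReal.toReal_ofReal (by norm_num)] at h4
  simp at h4
  rw [ENNReal.ofReal_le_iff_le_toReal (by finiteness)]
  simp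
  linarith

theorem aux_ind (c : ℝ) (hc : c ≤ 1 / 20000) :
    ∫⁻ x, ENNReal.ofReal (Real.exp ((1 / 50) * (22 / 100 - Set.indicator (Set.Ici (3 / 4 : ℝ)) 1 x)))
      ∂(gaussianReal 0 1) ≤ ENNReal.ofReal (Real.exp (-c)) := by
  set μ := gaussianReal 0 1
  set A := Set.Ici (3 / 4 : ℝ)
  have hA : MeasurableSet A := measurableSet_Ici
  rw [← lintegral_add_compl _ hA]
  have e1 : ∫⁻ x in A, ENNReal.ofReal (Real.exp ((1 / 50) * (22 / 100 - Set.indicator A 1 x))) ∂μ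
      = ENNReal.ofReal (Real.exp ((1 / 50) * (22 / 100 - 1))) * μ A := by
    rw [setLIntegral_congr_fun hA (g := fun _ => ENNReal.ofReal (Real.exp ((1 / 50) * (22 / 100 - 1))))]
    · simp
    · intro x hx; simp [hx]
  have e2 : ∫⁻ x in Aᶜ, ENNReal.ofReal (Real.exp ((1 / 50) * (22 / 100 - Set.indicator A 1 x))) ∂μ
      = ENNReal.ofReal (Real.exp ((1 / 50) * (22 / 100))) * μ Aᶜ := by
    rw [setLIntegral_congr_fun hA.compl (g := fun _ => ENNReal.ofReal (Real.exp ((1 / 50) * (22 / 100))))]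
    · simp
    · intro x hx
      have : x ∉ A := hx
      simp [this]
  rw [e1, e2, ← ofReal_measureReal (μ := μ) (s := A), ← ofReal_measureReal (μ := μ) (s := Aᶜ),
    ← ENNReal.ofReal_mul (by positivity), ← ENNReal.ofReal_mul (by positivity),
    ← ENNReal.ofReal_add (by positivity) (by positivity)]
  apply ENNReal.ofReal_le_ofReal
  rw [probReal_compl_eq_one_sub hA]
  have hp : 225 / 1000 ≤ μ.real A := by
    have := aux_tail
    rwa [ENNReal.ofReal_le_iff_le_toReal (by finiteness)] at this
  set p := μ.real A
  have h1 : Real.exp ((1 / 50) * (22 / 100 - 1)) = Real.exp ((1 / 50) * (22 / 100)) * Real.exp (-(1 / 50)) := by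
    rw [← Real.exp_add]; congr 1; norm_num
  have h2 := aux_exp_neg_le (y := 1 / 50) (by norm_num)
  have h3 : Real.exp (-(1 / 50)) * p + (1 - p) ≤ 1 - 225 / 1000 * (1 / 50 - (1 / 50) ^ 2 / 2) := by
    nlinarith
  have h4 : 1 - 225 / 1000 * (1 / 50 - (1 / 50) ^ 2 / 2) ≤
      Real.exp (- (225 / 1000 * (1 / 50 - (1 / 50) ^ 2 / 2))) := by
    have := Real.add_one_le_exp (- (225 / 1000 * (1 / 50 - (1 / 50) ^ 2 / 2) : ℝ))
    linarith
  rw [h1]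
  calc _ = Real.exp ((1 / 50) * (22 / 100)) * (Real.exp (-(1 / 50)) * p + (1 - p)) := by ring
    _ ≤ Real.exp ((1 / 50) * (22 / 100)) * Real.exp (- (225 / 1000 * (1 / 50 - (1 / 50) ^ 2 / 2))) := by
      gcongr; linarith
    _ ≤ _ := by
      rw [← Real.exp_add]; apply Real.exp_le_exp.2; norm_num; linarith

theorem aux_lin (c : ℝ) (hc : c ≤ 1 / 20000) :
    ∫⁻ x, ENNReal.ofReal (Real.exp ((1 / 20) * (x - 1 / 20)))
      ∂(gaussianReal 0 1) ≤ ENNReal.ofReal (Real.exp (-c)) := by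
  have : ∀ x : ℝ, ENNReal.ofReal (Real.exp ((1 / 20) * (x - 1 / 20)))
      = ENNReal.ofReal (Real.exp (1 / 20 * x)) * ENNReal.ofReal (Real.exp (-(1 / 400))) := by
    intro x
    rw [← ENNReal.ofReal_mul (by positivity), ← Real.exp_add]; congr 2; ring
  simp_rw [this]
  rw [lintegral_mul_const _ (by fun_prop), aux_mgf, ← ENNReal.ofReal_mul (by positivity), ← Real.exp_add]
  apply ENNReal.ofReal_le_ofReal
  apply Real.exp_le_exp.2; norm_num; linarith

theorem aux_sqc (c : ℝ) (hc : c ≤ 1 / 20000) :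
    ∫⁻ x, ENNReal.ofReal (Real.exp ((1 / 20) * (x ^ 2 - 11 / 10)))
      ∂(gaussianReal 0 1) ≤ ENNReal.ofReal (Real.exp (-c)) := by
  have : ∀ x : ℝ, ENNReal.ofReal (Real.exp ((1 / 20) * (x ^ 2 - 11 / 10)))
      = ENNReal.ofReal (Real.exp (1 / 20 * x ^ 2)) * ENNReal.ofReal (Real.exp (-(11 / 200))) := by
    intro x
    rw [← ENNReal.ofReal_mul (by positivity), ← Real.exp_add]; congr 2; ring
  simp_rw [this]
  rw [lintegral_mul_const _ (by fun_prop), aux_sq _ (by norm_num), ← ENNReal.ofReal_mul (by positivity)]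
  apply ENNReal.ofReal_le_ofReal
  have h1 : Real.exp (-(2 / 37)) ≤ Real.sqrt (1 - 2 * (1 / 20)) := by
    apply Real.le_sqrt_of_sq_le
    rw [← Real.exp_nat_mul]
    have := aux_exp_neg_le (y := 4 / 37) (by norm_num)
    have e : ((2 : ℕ) : ℝ) * -(2 / 37) = -(4 / 37) := by norm_num
    rw [e]
    norm_num at this ⊢
    linarith
  calc _ ≤ (Real.exp (-(2 / 37)))⁻¹ * Real.exp (-(11 / 200)) := by
        gcongr
    _ ≤ _ := by
      rw [← Real.exp_neg, ← Real.exp_add]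
      apply Real.exp_le_exp.2; norm_num; linarith

theorem aux_nest {n : ℕ} (u v : Fin n → ℝ) (hu : ∀ i, u i = 0 ∨ u i = 1) (hv : ∀ i, v i = 0 ∨ v i = 1)
    (h : (∀ i, u i = 1 → v i = 1) ∨ (∀ i, v i = 1 → u i = 1)) (α : ℝ)
    (h1 : α ≤ ∑ i, u i) (h2 : α ≤ ∑ i, v i) : α ≤ ∑ i, u i * v i := by
  rcases h with h | h
  · refine h1.trans_eq (Finset.sum_congr rfl fun i _ => ?_)
    rcases hu i with h' | h'
    · simp [h']
    · simp [h', h i h']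
  · refine h2.trans_eq (Finset.sum_congr rfl fun i _ => ?_)
    rcases hv i with h' | h'
    · simp [h']
    · simp [h', h i h']

theorem aux_ind01 (A : Set ℝ) (x : ℝ) : A.indicator (1 : ℝ → ℝ) x = 0 ∨ A.indicator (1 : ℝ → ℝ) x = 1 := by
  by_cases h : x ∈ A <;> simp [h]

theorem aux_ind1 (A : Set ℝ) (x : ℝ) : A.indicator (1 : ℝ → ℝ) x = 1 ↔ x ∈ A := by
  by_cases h : x ∈ A <;> simp [h]

theorem aux_mono_sum {n : ℕ} (G Y : Fin n → ℝ) (hG : Monotone G) (hY : Monotone Y) (a b α : ℝ)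
    (ha : 0 < a) (hb : 0 < b) (hα : 0 ≤ α)
    (g1 : α ≤ ∑ i, (Set.Ici b).indicator (1 : ℝ → ℝ) (G i))
    (g2 : α ≤ ∑ i, (Set.Iic (-b)).indicator (1 : ℝ → ℝ) (G i))
    (x1 : α ≤ ∑ i, (Set.Ici a).indicator (1 : ℝ → ℝ) (Y i))
    (x2 : α ≤ ∑ i, (Set.Iic (-a)).indicator (1 : ℝ → ℝ) (Y i)) :
    (∑ i, G i) * (∑ i, Y i) + 4 * (a * b) * α ^ 2 ≤ n * ∑ i, G i * Y i := by
  set t : Fin n → ℝ := fun i => (Set.Ici b).indicator (1 : ℝ → ℝ) (G i) * (Set.Ici a).indicator (1 : ℝ → ℝ) (Y i) with ht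
  set s : Fin n → ℝ := fun i => (Set.Iic (-b)).indicator (1 : ℝ → ℝ) (G i) * (Set.Iic (-a)).indicator (1 : ℝ → ℝ) (Y i) with hs
  have hT : α ≤ ∑ i, t i := by
    refine aux_nest _ _ (fun i => aux_ind01 _ _) (fun i => aux_ind01 _ _) ?_ α g1 x1
    simp only [aux_ind1, Set.mem_Ici]
    by_contra hc
    push Not at hc
    obtain ⟨⟨i, hi, hi'⟩, ⟨j, hj, hj'⟩⟩ := hc
    rcases le_total i j with h | h
    · linarith [hG h]
    · linarith [hY h]
  have hS : α ≤ ∑ i, s i := by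
    refine aux_nest _ _ (fun i => aux_ind01 _ _) (fun i => aux_ind01 _ _) ?_ α g2 x2
    simp only [aux_ind1, Set.mem_Iic]
    by_contra hc
    push Not at hc
    obtain ⟨⟨i, hi, hi'⟩, ⟨j, hj, hj'⟩⟩ := hc
    rcases le_total i j with h | h
    · linarith [hY h]
    · linarith [hG h]
  have key : ∀ i j, 4 * (a * b) * (t i * s j + s i * t j) ≤ (G i - G j) * (Y i - Y j) := by
    intro i j
    have nn : 0 ≤ (G i - G j) * (Y i - Y j) := by
      rcases le_total i j with h | h
      · exact mul_nonneg_of_nonpos_of_nonpos (by linarith [hG h]) (by linarith [hY h])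
      · exact mul_nonneg (by linarith [hG h]) (by linarith [hY h])
    have ht1 : ∀ i, (t i = 0 ∧ s i = 0) ∨ (t i = 1 ∧ s i = 0 ∧ b ≤ G i ∧ a ≤ Y i) ∨
        (t i = 0 ∧ s i = 1 ∧ G i ≤ -b ∧ Y i ≤ -a) := by
      intro i
      simp only [ht, hs, Set.indicator_apply, Set.mem_Ici, Set.mem_Iic, Pi.one_apply]
      by_cases h1 : b ≤ G i <;> by_cases h2 : a ≤ Y i <;> by_cases h3 : G i ≤ -b <;>
        by_cases h4 : Y i ≤ -a <;> simp [h1, h2, h3, h4] <;> linarith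
    rcases ht1 i with h | h | h <;> rcases ht1 j with h' | h' | h'
    all_goals first
      | (rw [h.1, h.2, h'.1, h'.2]; simpa using nn)
      | (rw [h.1, h.2.1, h'.1, h'.2]; simpa using nn)
      | (rw [h.1, h.2, h'.1, h'.2.1]; simpa using nn)
      | (rw [h.1, h.2.1, h'.1, h'.2.1])
    · simpa using nn
    · have : 2 * b * (2 * a) ≤ (G i - G j) * (Y i - Y j) :=
        mul_le_mul (by linarith) (by linarith) (by positivity) (by linarith)
      linarith
    · have : 2 * b * (2 * a) ≤ (G j - G i) * (Y j - Y i) :=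
        mul_le_mul (by linarith) (by linarith) (by positivity) (by linarith)
      linarith
    · simpa using nn
  have hsum : ∑ i, ∑ j, 4 * (a * b) * (t i * s j + s i * t j) ≤ ∑ i, ∑ j, (G i - G j) * (Y i - Y j) :=
    Finset.sum_le_sum fun i _ => Finset.sum_le_sum fun j _ => key i j
  have e1 : ∑ i, ∑ j, 4 * (a * b) * (t i * s j + s i * t j) = 8 * (a * b) * ((∑ i, t i) * ∑ i, s i) := by
    simp_rw [← Finset.mul_sum, Finset.sum_add_distrib]
    rw [← Finset.sum_mul_sum, ← Finset.sum_mul_sum]; ring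
  have e2 : ∑ i, ∑ j, (G i - G j) * (Y i - Y j) = 2 * (n * ∑ i, G i * Y i) - 2 * ((∑ i, G i) * ∑ i, Y i) := by
    have : ∀ i j, (G i - G j) * (Y i - Y j) = G i * Y i + G j * Y j - G i * Y j - G j * Y i := by
      intros; ring
    simp_rw [this, Finset.sum_sub_distrib, Finset.sum_add_distrib]
    have h3 : ∑ i, ∑ j, G j * Y i = (∑ i, G i) * ∑ i, Y i := by
      rw [Finset.sum_comm, ← Finset.sum_mul_sum]
    rw [h3, ← Finset.sum_mul_sum]
    simp [← Finset.mul_sum]; ring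
  rw [e1, e2] at hsum
  have : α ^ 2 ≤ (∑ i, t i) * ∑ i, s i := by
    rw [sq]; exact mul_le_mul hT hS hα (hα.trans hT)
  have := mul_le_mul_of_nonneg_left this (show 0 ≤ 8 * (a * b) by positivity)
  linarith

theorem aux_perm {n : ℕ} (g x : Fin n → ℝ) (a b α : ℝ)
    (ha : 0 < a) (hb : 0 < b) (hα : 0 ≤ α)
    (g1 : α ≤ ∑ i, (Set.Ici b).indicator (1 : ℝ → ℝ) (g i))
    (g2 : α ≤ ∑ i, (Set.Iic (-b)).indicator (1 : ℝ → ℝ) (g i))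
    (x1 : α ≤ ∑ i, (Set.Ici a).indicator (1 : ℝ → ℝ) (x i))
    (x2 : α ≤ ∑ i, (Set.Iic (-a)).indicator (1 : ℝ → ℝ) (x i)) :
    ∃ π : Equiv.Perm (Fin n),
      (∑ i, g i) * (∑ i, x i) + 4 * (a * b) * α ^ 2 ≤ n * ∑ i, g i * x (π i) := by
  refine ⟨(Tuple.sort g)⁻¹.trans (Tuple.sort x), ?_⟩
  have h := aux_mono_sum (g ∘ Tuple.sort g) (x ∘ Tuple.sort x) (Tuple.monotone_sort g)
    (Tuple.monotone_sort x) a b α ha hb hα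
    (g1.trans_eq (Equiv.sum_comp (Tuple.sort g) (fun i => (Set.Ici b).indicator (1 : ℝ → ℝ) (g i))).symm)
    (g2.trans_eq (Equiv.sum_comp (Tuple.sort g) (fun i => (Set.Iic (-b)).indicator (1 : ℝ → ℝ) (g i))).symm)
    (x1.trans_eq (Equiv.sum_comp (Tuple.sort x) (fun i => (Set.Ici a).indicator (1 : ℝ → ℝ) (x i))).symm)
    (x2.trans_eq (Equiv.sum_comp (Tuple.sort x) (fun i => (Set.Iic (-a)).indicator (1 : ℝ → ℝ) (x i))).symm)
  simp only [Function.comp_apply] at h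
  rw [Equiv.sum_comp (Tuple.sort g) g, Equiv.sum_comp (Tuple.sort x) x] at h
  refine h.trans_eq ?_
  congr 1
  rw [← Equiv.sum_comp (Tuple.sort g) (fun i => g i * x _)]
  simp

/-- Deterministic consequence of optimality. -/
theorem aux_opt {n d : ℕ} (hd : 1 ≤ d) (X : Matrix (Fin n) (Fin d) ℝ) (e : Fin n → ℝ)
    (P : Equiv.Perm (Fin n)) (β : Fin d → ℝ)
    (hmin : ∀ (π : Equiv.Perm (Fin n)) (b : Fin d → ℝ),
      l2 (permVec P (X *ᵥ β) - e) ^ 2 ≤ l2 (permVec π (X *ᵥ b) - e) ^ 2)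
    (π : Equiv.Perm (Fin n)) (t : ℝ) :
    2 * t * (∑ i, e i * X (π i) ⟨0, hd⟩) - t ^ 2 * (∑ i, X i ⟨0, hd⟩ ^ 2) ≤ ∑ i, (X *ᵥ β) i ^ 2 := by
  have l2sq : ∀ (π : Equiv.Perm (Fin n)) (w : Fin n → ℝ), l2 (permVec π w - e) ^ 2
      = ∑ i, w i ^ 2 - 2 * (∑ i, e i * w (π i)) + ∑ i, e i ^ 2 := by
    intro π w
    rw [l2, Real.sq_sqrt (Finset.sum_nonneg fun i _ => sq_nonneg _), ← Equiv.sum_comp π (fun i => w i ^ 2),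
      Finset.mul_sum, ← Finset.sum_sub_distrib, ← Finset.sum_add_distrib]
    refine Finset.sum_congr rfl fun i _ => ?_
    simp only [Pi.sub_apply, permVec]; ring
  set A := ∑ i, (X *ᵥ β) i ^ 2 with hA
  set B := ∑ i, e i * (X *ᵥ β) (P i) with hB
  have h1 : ∀ r : ℝ, A - 2 * B ≤ r ^ 2 * A - 2 * (r * B) := by
    intro r
    have := hmin P (r • β)
    rw [l2sq, l2sq, Matrix.mulVec_smul] at this
    have e1 : ∑ i, (r • (X *ᵥ β)) i ^ 2 = r ^ 2 * A := by
      rw [hA, Finset.mul_sum]; refine Finset.sum_congr rfl fun i _ => ?_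
      simp only [Pi.smul_apply, smul_eq_mul]; ring
    have e2 : ∑ i, e i * (r • (X *ᵥ β)) (P i) = r * B := by
      rw [hB, Finset.mul_sum]; refine Finset.sum_congr rfl fun i _ => ?_
      simp only [Pi.smul_apply, smul_eq_mul]; ring
    rw [e1, e2] at this
    linarith
  have hA0 : 0 ≤ A := Finset.sum_nonneg fun i _ => sq_nonneg _
  have hAB : A = B := by
    by_contra hne
    have hpos : 0 < (A - B) ^ 2 := by have := sub_ne_zero.2 hne; positivity
    have h2 := h1 (1 - (A - B) / (A + 1))
    have : (A - B) / (A + 1) * (A + 1) = A - B := by field_simp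
    set q := (A - B) / (A + 1)
    have h3 : 2 * q * (A - B) ≤ q ^ 2 * A := by nlinarith
    have h4 : 2 * q * (q * (A + 1)) ≤ q ^ 2 * A := by rw [this]; exact h3
    have h5 : q ^ 2 * (A + 2) ≤ 0 := by nlinarith
    have h6 : q = 0 := by
      by_contra hq
      have : 0 < q ^ 2 * (A + 2) := by positivity
      linarith
    rw [h6] at this
    apply hne; linarith
  have h2 := hmin π (Pi.single ⟨0, hd⟩ t)
  rw [l2sq, l2sq] at h2
  have hcol : ∀ i, (X *ᵥ Pi.single ⟨0, hd⟩ t) i = X i ⟨0, hd⟩ * t := by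
    intro i; simp
  simp_rw [hcol] at h2
  have e1 : ∑ i, (X i ⟨0, hd⟩ * t) ^ 2 = t ^ 2 * ∑ i, X i ⟨0, hd⟩ ^ 2 := by
    rw [Finset.mul_sum]; refine Finset.sum_congr rfl fun i _ => ?_
    ring
  have e2 : ∑ i, e i * (X (π i) ⟨0, hd⟩ * t) = t * ∑ i, e i * X (π i) ⟨0, hd⟩ := by
    rw [Finset.mul_sum]; refine Finset.sum_congr rfl fun i _ => ?_
    ring
  rw [e1, e2] at h2
  linarith

theorem aux_row {d : ℕ} (u : EuclideanSpace ℝ (Fin d)) (hu : ‖u‖ ≤ 5 / 4) :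
    ∫⁻ x : Fin d → ℝ, ENNReal.ofReal (Real.exp ((32 / 125) * (∑ j, x j * u j) ^ 2))
      ∂(Measure.pi fun _ => gaussianReal 0 1) ≤ ENNReal.ofReal (Real.sqrt 5) := by
  set k := Real.sqrt (64 / 125) with hk
  have hk2 : k ^ 2 = 64 / 125 := Real.sq_sqrt (by norm_num)
  have h1 : ∀ x : Fin d → ℝ, ENNReal.ofReal (Real.exp ((32 / 125) * (∑ j, x j * u j) ^ 2))
      = ∫⁻ z, ENNReal.ofReal (Real.exp ((k * ∑ j, x j * u j) * z)) ∂(gaussianReal 0 1) := by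
    intro x
    rw [aux_mgf, mul_pow, hk2]; congr 2; ring
  simp_rw [h1]
  rw [lintegral_lintegral_swap (by fun_prop)]
  have h2 : ∀ z : ℝ, ∫⁻ x : Fin d → ℝ, ENNReal.ofReal (Real.exp ((k * ∑ j, x j * u j) * z))
      ∂(Measure.pi fun _ => gaussianReal 0 1) = ENNReal.ofReal (Real.exp ((32 / 125 * ‖u‖ ^ 2) * z ^ 2)) := by
    intro z
    have : ∀ x : Fin d → ℝ, ENNReal.ofReal (Real.exp ((k * ∑ j, x j * u j) * z))
        = ∏ j, ENNReal.ofReal (Real.exp ((k * u j * z) * x j)) := by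
      intro x
      rw [← ENNReal.ofReal_prod_of_nonneg (fun i _ => (Real.exp_pos _).le), ← Real.exp_sum,
        Finset.mul_sum, Finset.sum_mul]
      congr 2
      exact Finset.sum_congr rfl fun j _ => by ring
    simp_rw [this]
    rw [aux_lintegral_pi_prod (fun _ : Fin d => gaussianReal 0 1)
      (fun j x => ENNReal.ofReal (Real.exp ((k * u j * z) * x))) (fun j => by fun_prop)]
    simp_rw [aux_mgf]
    rw [← ENNReal.ofReal_prod_of_nonneg (fun i _ => (Real.exp_pos _).le), ← Real.exp_sum,
      EuclideanSpace.real_norm_sq_eq, Finset.mul_sum, Finset.sum_mul]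
    congr 2
    refine Finset.sum_congr rfl fun j _ => ?_
    rw [mul_pow, mul_pow, hk2]; ring
  simp_rw [h2]
  have hu2 : ‖u‖ ^ 2 ≤ 25 / 16 := by nlinarith [norm_nonneg u]
  rw [aux_sq _ (by linarith)]
  apply ENNReal.ofReal_le_ofReal
  rw [← Real.sqrt_inv]
  apply Real.sqrt_le_sqrt
  rw [inv_le_comm₀ (by linarith) (by norm_num)]
  linarith

/-- Smoothed exponential functional. -/
def auxF {n d : ℕ} (X : Fin n → Fin d → ℝ) (u : EuclideanSpace ℝ (Fin d)) : ENNReal :=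
  ENNReal.ofReal (Real.exp ((32 / 125) * ∑ i, (∑ j, X i j * u j) ^ 2))

theorem auxF_meas {n d : ℕ} : Measurable (Function.uncurry (auxF (n := n) (d := d))) := by
  unfold auxF Function.uncurry
  fun_prop

theorem auxF_meas' {n d : ℕ} (X : Fin n → Fin d → ℝ) : Measurable (auxF X) := by
  unfold auxF
  fun_prop

theorem auxF_int {n d : ℕ} (u : EuclideanSpace ℝ (Fin d)) (hu : ‖u‖ ≤ 5 / 4) :
    ∫⁻ X, auxF X u ∂(μX n d) ≤ ENNReal.ofReal (Real.sqrt 5) ^ n := by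
  have h : ∀ X : Fin n → Fin d → ℝ, auxF X u
      = ∏ i, ENNReal.ofReal (Real.exp ((32 / 125) * (∑ j, X i j * u j) ^ 2)) := by
    intro X
    rw [← ENNReal.ofReal_prod_of_nonneg (fun i _ => (Real.exp_pos _).le), ← Real.exp_sum, auxF,
      Finset.mul_sum]
  simp_rw [h]
  rw [aux_lintegral_pi_prod (fun _ : Fin n => Measure.pi fun _ : Fin d => gaussianReal 0 1)
    (fun _ x => ENNReal.ofReal (Real.exp ((32 / 125) * (∑ j, x j * u j) ^ 2))) (fun _ => by fun_prop)]
  calc _ ≤ ∏ i : Fin n, ENNReal.ofReal (Real.sqrt 5) := Finset.prod_le_prod' fun i _ => aux_row u hu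
    _ = _ := by simp

theorem auxF_conv {n d : ℕ} (X : Fin n → Fin d → ℝ) (v w : EuclideanSpace ℝ (Fin d)) :
    auxF X v ≤ auxF X (v + w) + auxF X (v - w) := by
  have h : 2 * ∑ i, (∑ j, X i j * v j) ^ 2 ≤
      ∑ i, (∑ j, X i j * (v + w) j) ^ 2 + ∑ i, (∑ j, X i j * (v - w) j) ^ 2 := by
    rw [← Finset.sum_add_distrib, Finset.mul_sum]
    refine Finset.sum_le_sum fun i _ => ?_
    simp only [PiLp.add_apply, PiLp.sub_apply, mul_add, mul_sub, Finset.sum_add_distrib,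
      Finset.sum_sub_distrib]
    nlinarith [sq_nonneg (∑ j, X i j * w j)]
  rcases le_total (∑ i, (∑ j, X i j * v j) ^ 2) (∑ i, (∑ j, X i j * (v + w) j) ^ 2) with h1 | h1
  · refine le_trans ?_ le_self_add
    unfold auxF
    gcongr
  · refine le_trans ?_ le_add_self
    unfold auxF
    apply ENNReal.ofReal_le_ofReal
    apply Real.exp_le_exp.2
    linarith

theorem auxF_lower {n d : ℕ} (X : Fin n → Fin d → ℝ) (v : EuclideanSpace ℝ (Fin d)) (hv : ‖v‖ ≤ 1) :
    volume (Metric.ball (0 : EuclideanSpace ℝ (Fin d)) (1 / 4)) * auxF X v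
      ≤ 2 * ∫⁻ u in Metric.ball (0 : EuclideanSpace ℝ (Fin d)) (5 / 4), auxF X u := by
  set B4 := Metric.ball (0 : EuclideanSpace ℝ (Fin d)) (1 / 4)
  set B5 := Metric.ball (0 : EuclideanSpace ℝ (Fin d)) (5 / 4)
  have mB4 : MeasurableSet B4 := measurableSet_ball
  have mB5 : MeasurableSet B5 := measurableSet_ball
  have h1 : ∫⁻ w in B4, auxF X (v + w) ≤ ∫⁻ u in B5, auxF X u := by
    rw [← lintegral_indicator mB4, ← lintegral_indicator mB5,
      ← lintegral_add_left_eq_self (B5.indicator (auxF X)) v]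
    refine lintegral_mono fun w => ?_
    by_cases hw : w ∈ B4
    · have : v + w ∈ B5 := by
        simp only [B4, B5, mem_ball_zero_iff] at hw ⊢
        linarith [norm_add_le v w]
      simp [hw, this]
    · simp [hw]
  have h2 : ∫⁻ w in B4, auxF X (v - w) ≤ ∫⁻ u in B5, auxF X u := by
    rw [← lintegral_indicator mB4, ← lintegral_indicator mB5,
      ← lintegral_sub_left_eq_self (B5.indicator (auxF X)) v]
    refine lintegral_mono fun w => ?_
    by_cases hw : w ∈ B4
    · have : v - w ∈ B5 := by
        simp only [B4, B5, mem_ball_zero_iff] at hw ⊢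
        linarith [norm_sub_le v w]
      simp [hw, this]
    · simp [hw]
  calc _ = ∫⁻ w in B4, auxF X v := by simp [mul_comm]
    _ ≤ ∫⁻ w in B4, (auxF X (v + w) + auxF X (v - w)) := lintegral_mono fun w => auxF_conv X v w
    _ = (∫⁻ w in B4, auxF X (v + w)) + ∫⁻ w in B4, auxF X (v - w) :=
        lintegral_add_left ((auxF_meas' X).comp (by fun_prop)) _
    _ ≤ _ := by rw [two_mul]; exact add_le_add h1 h2

theorem aux_log5 : Real.log 5 ≤ 161 / 100 := by
  exact (Real.log_five_lt_d9.trans (by norm_num)).le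

theorem aux_op (n d : ℕ) (hd : 1 ≤ d) (hdn : d < n) :
    μX n d {X | ∃ v : EuclideanSpace ℝ (Fin d), ‖v‖ ≤ 1 ∧
      16 / 5 * (2 * n + d) ≤ ∑ i, (∑ j, X i j * v j) ^ 2}
      ≤ ENNReal.ofReal (2 * Real.exp (-(1 / 25) * n)) := by
  set T : ℝ := 16 / 5 * (2 * n + d) with hT
  set V := volume (Metric.ball (0 : EuclideanSpace ℝ (Fin d)) 1) with hV
  have hV0 : V ≠ 0 := (Metric.measure_ball_pos _ _ one_pos).ne'
  have hVt : V ≠ ⊤ := measure_ball_lt_top.ne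
  have hB4 : volume (Metric.ball (0 : EuclideanSpace ℝ (Fin d)) (1 / 4)) = ENNReal.ofReal ((1 / 4) ^ d) * V := by
    rw [Measure.addHaar_ball_of_pos _ _ (by norm_num)]; simp [V]
  have hB5 : volume (Metric.ball (0 : EuclideanSpace ℝ (Fin d)) (5 / 4)) = ENNReal.ofReal ((5 / 4) ^ d) * V := by
    rw [Measure.addHaar_ball_of_pos _ _ (by norm_num)]; simp [V]
  set κ := volume (Metric.ball (0 : EuclideanSpace ℝ (Fin d)) (1 / 4)) *
    ENNReal.ofReal (Real.exp (32 / 125 * T)) with hκ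
  have hmeas : Measurable fun X : Fin n → Fin d → ℝ =>
      2 * ∫⁻ u in Metric.ball (0 : EuclideanSpace ℝ (Fin d)) (5 / 4), auxF X u := by
    apply Measurable.const_mul
    exact Measurable.lintegral_prod_right auxF_meas
  set S := {X : Fin n → Fin d → ℝ | ∃ v : EuclideanSpace ℝ (Fin d), ‖v‖ ≤ 1 ∧
      T ≤ ∑ i, (∑ j, X i j * v j) ^ 2}
  have hsub : S ⊆ {X | κ ≤ 2 * ∫⁻ u in Metric.ball (0 : EuclideanSpace ℝ (Fin d)) (5 / 4), auxF X u} := by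
    rintro X ⟨v, hv, hTv⟩
    refine le_trans ?_ (auxF_lower X v hv)
    rw [hκ]
    gcongr
    unfold auxF
    gcongr
  have hint : ∫⁻ X, (2 * ∫⁻ u in Metric.ball (0 : EuclideanSpace ℝ (Fin d)) (5 / 4), auxF X u) ∂(μX n d)
      ≤ 2 * (ENNReal.ofReal (Real.sqrt 5) ^ n * volume (Metric.ball (0 : EuclideanSpace ℝ (Fin d)) (5 / 4))) := by
    rw [lintegral_const_mul _ (Measurable.lintegral_prod_right auxF_meas)]
    gcongr
    rw [lintegral_lintegral_swap auxF_meas.aemeasurable]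
    calc _ ≤ ∫⁻ u in Metric.ball (0 : EuclideanSpace ℝ (Fin d)) (5 / 4), ENNReal.ofReal (Real.sqrt 5) ^ n := by
          refine setLIntegral_mono (by fun_prop) fun u hu => auxF_int u ?_
          rw [mem_ball_zero_iff] at hu
          exact hu.le
      _ = _ := by simp
  have hM := (mul_le_mul_right (measure_mono (μ := μX n d) hsub) κ).trans
    ((mul_meas_ge_le_lintegral (μ := μX n d) hmeas κ).trans hint)
  rw [hκ, hB4, hB5, ← ofReal_measureReal (μ := μX n d) (s := S)] at hM
  set m := (μX n d).real S
  have hm : 0 ≤ m := measureReal_nonneg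
  have hM2 : V * ENNReal.ofReal ((1 / 4) ^ d * Real.exp (32 / 125 * T) * m) ≤
      V * ENNReal.ofReal (2 * (Real.sqrt 5 ^ n * (5 / 4) ^ d)) := by
    rw [ENNReal.ofReal_mul (by positivity), ENNReal.ofReal_mul (by positivity),
      ENNReal.ofReal_mul (by positivity), ENNReal.ofReal_mul (by positivity), ENNReal.ofReal_pow (p := Real.sqrt 5) (Real.sqrt_nonneg 5) n]
    rw [ENNReal.ofReal_ofNat]
    calc _ = _ := by ring
      _ ≤ _ := hM
      _ = _ := by ring
  rw [ENNReal.mul_le_mul_iff_right hV0 hVt, ENNReal.ofReal_le_ofReal_iff (by positivity)] at hM2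
  rw [← ofReal_measureReal (μ := μX n d) (s := S)]
  apply ENNReal.ofReal_le_ofReal
  change m ≤ _
  have e5 : (5 / 4 : ℝ) ^ d = (1 / 4) ^ d * Real.exp (d * Real.log 5) := by
    rw [Real.exp_nat_mul, Real.exp_log (by norm_num), ← mul_pow]; norm_num
  have e6 : Real.sqrt 5 ^ n = Real.exp (n * (Real.log 5 / 2)) := by
    rw [Real.exp_nat_mul, Real.exp_half, Real.exp_log (by norm_num)]
  rw [e5, e6] at hM2
  have hM3 : Real.exp (32 / 125 * T) * m ≤ 2 * (Real.exp (n * (Real.log 5 / 2)) * Real.exp (d * Real.log 5)) := by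
    have h4 : (0 : ℝ) < (1 / 4) ^ d := by positivity
    refine le_of_mul_le_mul_left ?_ h4
    calc _ = _ := by ring
      _ ≤ _ := hM2
      _ = _ := by ring
  rw [← Real.exp_add] at hM3
  have hl := aux_log5
  have hn : (d : ℝ) ≤ n := by exact_mod_cast hdn.le
  have hd0 : (0 : ℝ) ≤ d := by positivity
  have hexp : n * (Real.log 5 / 2) + d * Real.log 5 ≤ 32 / 125 * T + -(1 / 25) * n := by
    have h1 : (n : ℝ) * (Real.log 5 / 2) ≤ n * (161 / 200) :=
      mul_le_mul_of_nonneg_left (by linarith) (by positivity)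
    have h2 : (d : ℝ) * Real.log 5 ≤ d * (161 / 100) := mul_le_mul_of_nonneg_left (by linarith) hd0
    rw [hT]; nlinarith
  have h7 : Real.exp (n * (Real.log 5 / 2) + d * Real.log 5) ≤ Real.exp (32 / 125 * T) * Real.exp (-(1 / 25) * n) := by
    rw [← Real.exp_add]; exact Real.exp_le_exp.2 hexp
  refine le_of_mul_le_mul_left ?_ (Real.exp_pos (32 / 125 * T))
  linarith

theorem aux_evX (n d : ℕ) (hd : 1 ≤ d) (f : ℝ → ℝ) (hf : Measurable f) (c : ℝ)
    (h : ∫⁻ x, ENNReal.ofReal (Real.exp (f x)) ∂(gaussianReal 0 1) ≤ ENNReal.ofReal (Real.exp (-c))) :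
    μX n d {X | 0 ≤ ∑ i, f (X i ⟨0, hd⟩)} ≤ ENNReal.ofReal (Real.exp (-c * n)) := by
  refine aux_chernoff (Measure.pi fun _ : Fin d => gaussianReal 0 1) (fun x => f (x ⟨0, hd⟩))
    (by fun_prop) n c ?_
  have := (measurePreserving_eval (fun _ : Fin d => gaussianReal 0 1) ⟨0, hd⟩).lintegral_comp
    (f := fun x => ENNReal.ofReal (Real.exp (f x))) (by fun_prop)
  exact this.trans_le h

instance auxProbNoise (σ : ℝ) : IsProbabilityMeasure (gaussianReal 0 ⟨σ ^ 2, sq_nonneg σ⟩) :=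
  instIsProbabilityMeasureGaussianReal _ _

theorem aux_evN (n : ℕ) (σ : ℝ) (hσ : 0 < σ) (f : ℝ → ℝ) (hf : Measurable f) (c : ℝ)
    (h : ∫⁻ x, ENNReal.ofReal (Real.exp (f x)) ∂(gaussianReal 0 1) ≤ ENNReal.ofReal (Real.exp (-c))) :
    μNoise n σ {e | 0 ≤ ∑ i, f (e i / σ)} ≤ ENNReal.ofReal (Real.exp (-c * n)) := by
  refine aux_chernoff (gaussianReal 0 ⟨σ ^ 2, sq_nonneg σ⟩) (fun x => f (x / σ))
    (by fun_prop) n c ?_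
  have hm : (gaussianReal 0 1).map (σ * ·) = gaussianReal 0 ⟨σ ^ 2, sq_nonneg σ⟩ := by
    rw [gaussianReal_map_const_mul, mul_zero, mul_one]; rfl
  rw [← hm, lintegral_map (by fun_prop) (by fun_prop)]
  simpa [mul_div_assoc, mul_div_cancel_left₀, hσ.ne'] using h

def auxI (x : ℝ) : ℝ := (1 / 50) * (22 / 100 - Set.indicator (Set.Ici (3 / 4 : ℝ)) (1 : ℝ → ℝ) x)
def auxL (x : ℝ) : ℝ := (1 / 20) * (x - 1 / 20)
def auxQ (x : ℝ) : ℝ := (1 / 20) * (x ^ 2 - 11 / 10)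

theorem auxI_meas : Measurable auxI := by
  unfold auxI
  have : Measurable (Set.indicator (Set.Ici (3 / 4 : ℝ)) (1 : ℝ → ℝ)) :=
    measurable_one.indicator measurableSet_Ici
  fun_prop
theorem auxL_meas : Measurable auxL := by unfold auxL; fun_prop
theorem auxQ_meas : Measurable auxQ := by unfold auxQ; fun_prop

theorem auxI_sum {n : ℕ} (x : Fin n → ℝ) (h : ¬ 0 ≤ ∑ i, auxI (x i)) :
    22 / 100 * n ≤ ∑ i, Set.indicator (Set.Ici (3 / 4 : ℝ)) (1 : ℝ → ℝ) (x i) := by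
  simp only [auxI, ← Finset.mul_sum, Finset.sum_sub_distrib, Finset.sum_const, Finset.card_univ,
    Fintype.card_fin, nsmul_eq_mul] at h
  push Not at h
  linarith
theorem auxL_sum {n : ℕ} (x : Fin n → ℝ) (h : ¬ 0 ≤ ∑ i, auxL (x i)) :
    ∑ i, x i ≤ n / 20 := by
  simp only [auxL, ← Finset.mul_sum, Finset.sum_sub_distrib, Finset.sum_const, Finset.card_univ,
    Fintype.card_fin, nsmul_eq_mul] at h
  push Not at h
  linarith
theorem auxQ_sum {n : ℕ} (x : Fin n → ℝ) (h : ¬ 0 ≤ ∑ i, auxQ (x i)) :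
    ∑ i, x i ^ 2 ≤ 11 / 10 * n := by
  simp only [auxQ, ← Finset.mul_sum, Finset.sum_sub_distrib, Finset.sum_const, Finset.card_univ,
    Fintype.card_fin, nsmul_eq_mul] at h
  push Not at h
  linarith

theorem aux_det {n d : ℕ} (hd : 1 ≤ d) (hdn : d < n) (σ : ℝ) (hσ : 0 < σ)
    (X : Matrix (Fin n) (Fin d) ℝ) (e : Fin n → ℝ) (P : Equiv.Perm (Fin n)) (β : Fin d → ℝ)
    (hmin : ∀ (π : Equiv.Perm (Fin n)) (b : Fin d → ℝ),
      l2 (permVec P (X *ᵥ β) - e) ^ 2 ≤ l2 (permVec π (X *ᵥ b) - e) ^ 2)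
    (hop : ¬ ∃ v : EuclideanSpace ℝ (Fin d), ‖v‖ ≤ 1 ∧
      16 / 5 * (2 * n + d) ≤ ∑ i, (∑ j, X i j * v j) ^ 2)
    (hQ : ¬ 0 ≤ ∑ i, auxQ (X i ⟨0, hd⟩))
    (x1 : ¬ 0 ≤ ∑ i, auxI (X i ⟨0, hd⟩)) (x2 : ¬ 0 ≤ ∑ i, auxI (-X i ⟨0, hd⟩))
    (x3 : ¬ 0 ≤ ∑ i, auxL (X i ⟨0, hd⟩)) (x4 : ¬ 0 ≤ ∑ i, auxL (-X i ⟨0, hd⟩))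
    (e1 : ¬ 0 ≤ ∑ i, auxI (e i / σ)) (e2 : ¬ 0 ≤ ∑ i, auxI (-(e i / σ)))
    (e3 : ¬ 0 ≤ ∑ i, auxL (e i / σ)) (e4 : ¬ 0 ≤ ∑ i, auxL (-(e i / σ))) :
    ((n : ℝ) / (2 * n + d)) * (σ ^ 2 / (32 * Real.pi ^ 2)) ≤ l2 β ^ 2 := by
  have hn : (0 : ℝ) < n := by exact_mod_cast (by omega : 0 < n)
  have hQ' := auxQ_sum _ hQ
  have x1' := auxI_sum _ x1
  have x2' := auxI_sum _ x2
  have x3' := auxL_sum _ x3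
  have x4' := auxL_sum _ x4
  have e1' := auxI_sum _ e1
  have e2' := auxI_sum _ e2
  have e3' := auxL_sum _ e3
  have e4' := auxL_sum _ e4
  have hneg : ∀ y : ℝ, Set.indicator (Set.Ici (3 / 4 : ℝ)) (1 : ℝ → ℝ) (-y)
      = Set.indicator (Set.Iic (-(3 / 4) : ℝ)) (1 : ℝ → ℝ) y := by
    intro y
    simp only [Set.indicator_apply, Set.mem_Ici, Set.mem_Iic, le_neg, Pi.one_apply]
  have hsc1 : ∀ y : ℝ, Set.indicator (Set.Ici (3 / 4 : ℝ)) (1 : ℝ → ℝ) (y / σ)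
      = Set.indicator (Set.Ici (3 / 4 * σ)) (1 : ℝ → ℝ) y := by
    intro y
    simp only [Set.indicator_apply, Set.mem_Ici, le_div_iff₀ hσ, Pi.one_apply]
  have hsc2 : ∀ y : ℝ, Set.indicator (Set.Iic (-(3 / 4) : ℝ)) (1 : ℝ → ℝ) (y / σ)
      = Set.indicator (Set.Iic (-(3 / 4 * σ))) (1 : ℝ → ℝ) y := by
    intro y
    simp only [Set.indicator_apply, Set.mem_Iic, div_le_iff₀ hσ, neg_mul, Pi.one_apply]
  simp_rw [hneg] at x2' e2'
  simp_rw [hsc2] at e2'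
  simp_rw [hsc1] at e1'
  rw [Finset.sum_neg_distrib] at x4' e4'
  rw [← Finset.sum_div] at e3' e4'
  obtain ⟨π, hπ⟩ := aux_perm e (fun i => X i ⟨0, hd⟩) (3 / 4) (3 / 4 * σ) (22 / 100 * n)
    (by norm_num) (by positivity) (by positivity) e1' e2' x1' x2'
  set M := ∑ i, e i * X (π i) ⟨0, hd⟩
  set sx := ∑ i, X i ⟨0, hd⟩
  set se := ∑ i, e i
  rw [div_le_iff₀ hσ] at e3'
  rw [neg_le_iff_add_nonneg, ← sub_le_iff_le_add', zero_sub, le_div_iff₀ hσ] at e4'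
  have hprod : -(σ * n ^ 2 / 400) ≤ se * sx := by
    have h1 : |se| ≤ n / 20 * σ := abs_le.2 ⟨by linarith, e3'⟩
    have h2 : |sx| ≤ n / 20 := abs_le.2 ⟨by linarith, x3'⟩
    have h3 : |se * sx| ≤ n / 20 * σ * (n / 20) := by
      rw [abs_mul]; exact mul_le_mul h1 h2 (abs_nonneg _) (by positivity)
    have := (abs_le.1 h3).1
    linarith
  have hM : 1064 / 10000 * σ * n ≤ M := by
    refine le_of_mul_le_mul_left ?_ hn
    refine le_trans ?_ hπ
    nlinarith
  have hA := aux_opt hd X e P β hmin π (97 / 1000 * σ)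
  set A := ∑ i, (X *ᵥ β) i ^ 2 with hAdef
  have hA2 : 10291 / 1000000 * σ ^ 2 * n ≤ A := by
    have h1 : 2 * (97 / 1000 * σ) * (1064 / 10000 * σ * n) ≤ 2 * (97 / 1000 * σ) * M := by gcongr
    have h2 : (97 / 1000 * σ) ^ 2 * ∑ i, X i ⟨0, hd⟩ ^ 2 ≤ (97 / 1000 * σ) ^ 2 * (11 / 10 * n) := by gcongr
    have h3 : 0 < σ ^ 2 * n := by positivity
    nlinarith
  set L := ∑ j, β j ^ 2 with hL
  have hL0 : 0 ≤ L := Finset.sum_nonneg fun i _ => sq_nonneg _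
  have hl2 : l2 β ^ 2 = L := by rw [l2, Real.sq_sqrt hL0]
  have hA3 : A ≤ 16 / 5 * (2 * n + d) * L := by
    rcases hL0.eq_or_lt with h0 | h0
    · have : β = 0 := by
        funext j
        have := (Finset.sum_eq_zero_iff_of_nonneg (fun i _ => sq_nonneg (β i))).1 h0.symm j (Finset.mem_univ _)
        simpa using this
      rw [hAdef, this, ← h0]; simp
    · push Not at hop
      have hs : 0 < Real.sqrt L := Real.sqrt_pos.2 h0
      have hs2 : Real.sqrt L ^ 2 = L := Real.sq_sqrt hL0
      have := hop (WithLp.toLp 2 (fun j => β j / Real.sqrt L)) (by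
        rw [EuclideanSpace.norm_eq]
        simp only [Real.norm_eq_abs, sq_abs, div_pow, hs2, ← Finset.sum_div]
        rw [← hL, div_self h0.ne']; simp)
      have e : ∑ i, (∑ j, X i j * (WithLp.toLp 2 (fun j => β j / Real.sqrt L) : EuclideanSpace ℝ (Fin d)) j) ^ 2
          = A / L := by
        rw [hAdef, Finset.sum_div]
        refine Finset.sum_congr rfl fun i _ => ?_
        simp only [← mul_div_assoc, ← Finset.sum_div, div_pow, hs2]
        rfl
      rw [e, div_lt_iff₀ h0] at this
      exact this.le
  rw [hl2]
  have hpi : (985 / 100 : ℝ) ≤ Real.pi ^ 2 := by nlinarith [Real.pi_gt_d2]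
  have hK : (0 : ℝ) < 2 * n + d := by positivity
  have h9 : 10291 / 1000000 * σ ^ 2 * n / (16 / 5 * (2 * n + d)) ≤ L := by
    rw [div_le_iff₀ (by positivity)]; linarith
  refine le_trans ?_ h9
  rw [div_mul_div_comm, div_le_div_iff₀ (by positivity) (by positivity)]
  have : 0 ≤ σ ^ 2 * n * (2 * n + d) := by positivity
  nlinarith

/-- **Proposition 1 (negative result for unconstrained least squares).**
Let `n > d ≥ 1`, `X` with iid `N(0,1)` entries, `y = ε` with iid `N(0,σ²)` entries
independent of `X` (i.e. `β* = 0`, `Π* = I`).  If `(Π̂, β̂)` minimizes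
`‖Π X β - y‖₂²` over all permutation matrices `Π` and `β ∈ ℝ^d`, then there are
absolute constants `c, C > 0` such that with probability at least `1 - C exp(-c n)`,
`‖β̂‖₂² ≥ (n/(2n+d)) σ²/(32 π²)`. -/
theorem unconstrained_ls_overfits :
    ∃ c C : ℝ, 0 < c ∧ 0 < C ∧
      ∀ (n d : ℕ), 1 ≤ d → d < n →
      ∀ σ : ℝ, 0 < σ →
      ∀ (Phat : Ω n d → Equiv.Perm (Fin n)) (βhat : Ω n d → Fin d → ℝ),
      (∀ ω : Ω n d, ∀ (π : Equiv.Perm (Fin n)) (b : Fin d → ℝ),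
          l2 (permVec (Phat ω) (desX ω *ᵥ βhat ω) - ω.2) ^ 2 ≤
          l2 (permVec π (desX ω *ᵥ b) - ω.2) ^ 2) →
      μData n d σ
          {ω : Ω n d | ((n : ℝ) / (2 * n + d)) * (σ ^ 2 / (32 * Real.pi ^ 2)) ≤ l2 (βhat ω) ^ 2}
        ≥ ENNReal.ofReal (1 - C * Real.exp (-c * n)) := by
  refine ⟨1 / 20000, 11, by norm_num, by norm_num, ?_⟩
  intro n d hd hdn σ hσ Phat βhat hmin
  have cI := aux_ind (1 / 20000) le_rfl
  have cL := aux_lin (1 / 20000) le_rfl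
  have cQ := aux_sqc (1 / 20000) le_rfl
  have cI' := (aux_neg (fun x => ENNReal.ofReal (Real.exp (auxI x)))
    (by have := auxI_meas; fun_prop)).trans_le cI
  have cL' := (aux_neg (fun x => ENNReal.ofReal (Real.exp (auxL x)))
    (by have := auxL_meas; fun_prop)).trans_le cL
  have mI' : Measurable fun x => auxI (-x) := auxI_meas.comp measurable_neg
  have mL' : Measurable fun x => auxL (-x) := auxL_meas.comp measurable_neg
  set δ := ENNReal.ofReal (Real.exp (-(1 / 20000) * n)) with hδ
  have b0 := aux_op n d hd hdn
  have b1 := aux_evX n d hd auxQ auxQ_meas _ cQ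
  have b2 := aux_evX n d hd auxI auxI_meas _ cI
  have b3 := aux_evX n d hd _ mI' _ cI'
  have b4 := aux_evX n d hd auxL auxL_meas _ cL
  have b5 := aux_evX n d hd _ mL' _ cL'
  have d2 := aux_evN n σ hσ auxI auxI_meas _ cI
  have d3 := aux_evN n σ hσ _ mI' _ cI'
  have d4 := aux_evN n σ hσ auxL auxL_meas _ cL
  have d5 := aux_evN n σ hσ _ mL' _ cL'
  set S0 := {X : Fin n → Fin d → ℝ | ∃ v : EuclideanSpace ℝ (Fin d), ‖v‖ ≤ 1 ∧
      16 / 5 * (2 * n + d) ≤ ∑ i, (∑ j, X i j * v j) ^ 2} with hS0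
  set S1 := {X : Fin n → Fin d → ℝ | 0 ≤ ∑ i, auxQ (X i ⟨0, hd⟩)} with hS1
  set S2 := {X : Fin n → Fin d → ℝ | 0 ≤ ∑ i, auxI (X i ⟨0, hd⟩)} with hS2
  set S3 := {X : Fin n → Fin d → ℝ | 0 ≤ ∑ i, auxI (-X i ⟨0, hd⟩)} with hS3
  set S4 := {X : Fin n → Fin d → ℝ | 0 ≤ ∑ i, auxL (X i ⟨0, hd⟩)} with hS4
  set S5 := {X : Fin n → Fin d → ℝ | 0 ≤ ∑ i, auxL (-X i ⟨0, hd⟩)} with hS5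
  set R2 := {e : Fin n → ℝ | 0 ≤ ∑ i, auxI (e i / σ)} with hR2
  set R3 := {e : Fin n → ℝ | 0 ≤ ∑ i, auxI (-(e i / σ))} with hR3
  set R4 := {e : Fin n → ℝ | 0 ≤ ∑ i, auxL (e i / σ)} with hR4
  set R5 := {e : Fin n → ℝ | 0 ≤ ∑ i, auxL (-(e i / σ))} with hR5
  set G := {ω : Ω n d | ((n : ℝ) / (2 * n + d)) * (σ ^ 2 / (32 * Real.pi ^ 2)) ≤ l2 (βhat ω) ^ 2} with hG
  have b0' : μX n d S0 ≤ δ + δ := by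
    refine b0.trans ?_
    rw [hδ, ← ENNReal.ofReal_add (Real.exp_pos _).le (Real.exp_pos _).le, ← two_mul]
    apply ENNReal.ofReal_le_ofReal
    have : (0 : ℝ) ≤ n := by positivity
    gcongr
    norm_num
  have hX : μX n d (S0 ∪ S1 ∪ S2 ∪ S3 ∪ S4 ∪ S5) ≤ δ + δ + δ + δ + δ + δ + δ := by
    refine (measure_union_le _ _).trans (add_le_add ?_ b5)
    refine (measure_union_le _ _).trans (add_le_add ?_ b4)
    refine (measure_union_le _ _).trans (add_le_add ?_ b3)
    refine (measure_union_le _ _).trans (add_le_add ?_ b2)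
    exact (measure_union_le _ _).trans (add_le_add b0' b1)
  have hN : μNoise n σ (R2 ∪ R3 ∪ R4 ∪ R5) ≤ δ + δ + δ + δ := by
    refine (measure_union_le _ _).trans (add_le_add ?_ d5)
    refine (measure_union_le _ _).trans (add_le_add ?_ d4)
    exact (measure_union_le _ _).trans (add_le_add d2 d3)
  have hcover : (Set.univ : Set (Ω n d)) ⊆ (G ∪ (S0 ∪ S1 ∪ S2 ∪ S3 ∪ S4 ∪ S5) ×ˢ Set.univ) ∪
      Set.univ ×ˢ (R2 ∪ R3 ∪ R4 ∪ R5) := by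
    intro ω _
    by_contra hc
    simp only [Set.mem_union, Set.mem_prod, Set.mem_univ, and_true, true_and, not_or] at hc
    obtain ⟨⟨hg, ⟨⟨⟨⟨h0, h1⟩, h2⟩, h3⟩, h4⟩, h5⟩, ⟨⟨k2, k3⟩, k4⟩, k5⟩ := hc
    exact hg (aux_det hd hdn σ hσ (desX ω) ω.2 (Phat ω) (βhat ω) (hmin ω) h0 h1 h2 h3 h4 h5 k2 k3 k4 k5)
  have h1 : (1 : ENNReal) ≤ μData n d σ G + ENNReal.ofReal (11 * Real.exp (-(1 / 20000) * n)) := by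
    calc (1 : ENNReal) = μData n d σ Set.univ := measure_univ.symm
      _ ≤ _ := measure_mono hcover
      _ ≤ _ := measure_union_le _ _
      _ ≤ _ := add_le_add (measure_union_le _ _) le_rfl
      _ ≤ μData n d σ G + (δ + δ + δ + δ + δ + δ + δ) + (δ + δ + δ + δ) := by
        gcongr
        · rw [Measure.prod_prod, measure_univ, mul_one]; exact hX
        · rw [Measure.prod_prod, measure_univ, one_mul]; exact hN
      _ = _ := by
        rw [ENNReal.ofReal_mul (by norm_num), ← hδ, ENNReal.ofReal_ofNat]; ring
  rw [ge_iff_le, ENNReal.ofReal_sub _ (by positivity), ENNReal.ofReal_one, tsub_le_iff_right]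
  exact h1

end
end

section
/- Let x_1,…,x_n be i.i.d. N(0, I_d) random vectors in ℝ^d with n ≥ 5, let β* ∈ ℝ^d \ {0}, and for γ > 0 define the event A_γ := { min_{i<j} (x_iᵀβ* − x_jᵀβ*)² ≤ γ² }. If ‖β*‖₂² ≤ (1/(25π))·n²·γ², then P(A_γ) ≥ 0.85. -/
open MeasureTheory ProbabilityTheory

noncomputable section

lemma aux_mgf_s14 {d : ℕ} (β : Fin d → ℝ) :
    mgf (fun y : Fin d → ℝ => ∑ l, y l * β l) (Measure.pi fun _ => stdGaussian)
      = fun t => Real.exp ((∑ l, β l ^ 2) * t ^ 2 / 2) := by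
  have hind : iIndepFun (fun (l : Fin d) (y : Fin d → ℝ) => y l * β l)
      (Measure.pi fun _ => stdGaussian) :=
    iIndepFun_pi (X := fun (l : Fin d) (u : ℝ) => u * β l) (fun l => by fun_prop)
  funext t
  have h1 := hind.mgf_sum (t := t) (fun l => by fun_prop) Finset.univ
  have h2 : (∑ l, fun (y : Fin d → ℝ) => y l * β l) = fun y => ∑ l, y l * β l := by
    funext y; simp
  rw [h2] at h1
  rw [h1]
  have h3 : ∀ l, mgf (fun (y : Fin d → ℝ) => y l * β l) (Measure.pi fun _ => stdGaussian) t
      = Real.exp (β l ^ 2 * t ^ 2 / 2) := by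
    intro l
    have hp := (measurePreserving_eval (fun _ : Fin d => stdGaussian) l)
    have : (Measure.pi fun _ : Fin d => stdGaussian).map (fun y => y l * β l)
        = gaussianReal (β l * 0) (NNReal.mk (β l ^ 2) (sq_nonneg _) * 1) := by
      rw [← gaussianReal_map_mul_const]
      have h4 := Measure.map_map (μ := Measure.pi fun _ : Fin d => stdGaussian)
        (g := fun u : ℝ => u * β l) (by fun_prop) hp.measurable
      rw [hp.map_eq] at h4
      exact h4.symm
    rw [mgf_gaussianReal this]
    simp
  simp_rw [h3]
  rw [← Real.exp_sum, Finset.sum_mul, Finset.sum_div]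

lemma aux_deriv (s : ℝ) :
    iteratedDeriv 4 (fun t : ℝ => Real.exp (s * t ^ 2 / 2)) 0 = 3 * s ^ 2 := by
  have he : ∀ t : ℝ, HasDerivAt (fun t : ℝ => Real.exp (s * t ^ 2 / 2))
      (Real.exp (s * t ^ 2 / 2) * (s * t)) t := by
    intro t
    have : HasDerivAt (fun t : ℝ => s * t ^ 2 / 2) (s * t) t := by
      have := (((hasDerivAt_id t).pow 2).const_mul s).div_const 2
      convert! this using 1
      simp; ring
    exact this.exp
  have hm : ∀ (p p' : ℝ → ℝ), (∀ t, HasDerivAt p (p' t) t) →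
      deriv (fun t : ℝ => Real.exp (s * t ^ 2 / 2) * p t)
        = fun t => Real.exp (s * t ^ 2 / 2) * (s * t * p t + p' t) := by
    intro p p' hp
    funext t
    refine ((he t).mul (hp t)).deriv.trans ?_
    ring
  have hi : ∀ t : ℝ, HasDerivAt (fun t : ℝ => t) 1 t := fun t => hasDerivAt_id t
  have hpow : ∀ (k : ℕ) (t : ℝ), HasDerivAt (fun t : ℝ => t ^ k) (k * t ^ (k - 1)) t :=
    fun k t => hasDerivAt_pow k t
  simp only [iteratedDeriv_succ, iteratedDeriv_zero]
  rw [show deriv (fun t : ℝ => Real.exp (s * t ^ 2 / 2))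
    = fun t => Real.exp (s * t ^ 2 / 2) * (s * t) from funext fun t => (he t).deriv]
  rw [hm (fun t => s * t) (fun t => s * 1) (fun t => (hi t).const_mul s)]
  rw [hm (fun t => s * t * (s * t) + s * 1) (fun t => 2 * s ^ 2 * t) (fun t => by
    have := (((hi t).const_mul s).mul ((hi t).const_mul s)).add_const (s * 1)
    convert! this using 1; ring)]
  rw [hm (fun t => s * t * (s * t * (s * t) + s * 1) + 2 * s ^ 2 * t)
    (fun t => 3 * s ^ 3 * t ^ 2 + 3 * s ^ 2) (fun t => by
    have h1 := ((hpow 3 t).const_mul (s ^ 3)).add ((hi t).const_mul (3 * s ^ 2))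
    convert! h1 using 1
    · funext u; simp only [Pi.add_apply]; ring
    · push_cast; ring)]
  simp

lemma aux_moment {d : ℕ} (β : Fin d → ℝ) :
    Integrable (fun y : Fin d → ℝ => (∑ l, y l * β l) ^ 4) (Measure.pi fun _ => stdGaussian) ∧
    ∫ y : Fin d → ℝ, (∑ l, y l * β l) ^ 4 ∂(Measure.pi fun _ => stdGaussian)
      = 3 * (∑ l, β l ^ 2) ^ 2 := by
  have hset : integrableExpSet (fun y : Fin d → ℝ => ∑ l, y l * β l)
      (Measure.pi fun _ => stdGaussian) = Set.univ := by
    ext t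
    simp only [Set.mem_univ, iff_true]
    by_contra h
    have h1 : mgf (fun y : Fin d → ℝ => ∑ l, y l * β l) (Measure.pi fun _ => stdGaussian) t = 0 :=
      integral_undef h
    rw [aux_mgf_s14] at h1
    exact (Real.exp_pos _).ne' h1
  have h0 : (0 : ℝ) ∈ interior (integrableExpSet (fun y : Fin d → ℝ => ∑ l, y l * β l)
      (Measure.pi fun _ => stdGaussian)) := by rw [hset]; simp
  refine ⟨integrable_pow_of_mem_interior_integrableExpSet h0 4, ?_⟩
  have := iteratedDeriv_mgf_zero h0 4
  rw [aux_mgf_s14, aux_deriv] at this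
  rw [this]; rfl

lemma aux_sum (n : ℕ) : ∑ i : Fin n, ∑ j : Fin n, (((i : ℕ) : ℝ) - ((j : ℕ) : ℝ)) ^ 4
    = (n : ℝ) ^ 2 * ((n : ℝ) ^ 2 - 1) * (2 * (n : ℝ) ^ 2 - 3) / 30 := by
  have hT : ∀ (a : ℝ) (m : ℕ), ∑ i ∈ Finset.range m, (a - (i : ℝ)) ^ 4
      = m * a ^ 4 - 4 * a ^ 3 * (m * (m - 1) / 2) + 6 * a ^ 2 * ((m - 1) * m * (2 * m - 1) / 6)
        - 4 * a * (m * (m - 1) / 2) ^ 2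
        + (m - 1) * m * (2 * m - 1) * (3 * (m - 1) ^ 2 + 3 * (m - 1) - 1) / 30 := by
    intro a m
    induction m with
    | zero => simp
    | succ k ih => rw [Finset.sum_range_succ, ih]; push_cast; ring
  have h1 : ∀ i : ℕ, ∑ j : Fin n, ((i : ℝ) - ((j : ℕ) : ℝ)) ^ 4
      = ∑ j ∈ Finset.range n, ((i : ℝ) - (j : ℝ)) ^ 4 := fun i =>
    Fin.sum_univ_eq_sum_range (fun j => ((i : ℝ) - (j : ℝ)) ^ 4) n
  simp_rw [h1]
  rw [Fin.sum_univ_eq_sum_range (fun i => ∑ j ∈ Finset.range n, ((i : ℝ) - (j : ℝ)) ^ 4) n]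
  induction n with
  | zero => simp
  | succ k ih =>
    rw [Finset.sum_range_succ]
    simp_rw [Finset.sum_range_succ _ k]
    rw [Finset.sum_add_distrib, ih (fun i =>
      Fin.sum_univ_eq_sum_range (fun j => ((i : ℝ) - (j : ℝ)) ^ 4) k)]
    have h2 : ∀ i : ℕ, ((i : ℝ) - (k : ℝ)) ^ 4 = ((k : ℝ) - i) ^ 4 := fun i => by ring
    simp_rw [h2]
    rw [hT]
    push_cast; ring

lemma aux_gap (m : ℕ) (Y : Fin (m + 1) → ℝ) (γ : ℝ) (hγ : 0 < γ)
    (h : ∀ i j, i < j → γ ^ 2 < (Y i - Y j) ^ 2) :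
    γ ^ 4 * ∑ i : Fin (m + 1), ∑ j : Fin (m + 1), (((i : ℕ) : ℝ) - ((j : ℕ) : ℝ)) ^ 4
      ≤ 16 * ((m + 1 : ℕ) : ℝ) * ∑ i, Y i ^ 4 := by
  set e := Tuple.sort Y
  have hmono : Monotone (Y ∘ e) := Tuple.monotone_sort Y
  have h' : ∀ i j, i ≠ j → γ ^ 2 < (Y i - Y j) ^ 2 := by
    intro i j hij
    rcases lt_or_gt_of_ne hij with hl | hl
    · exact h i j hl
    · have := h j i hl
      nlinarith
  have hf : Monotone (fun k : Fin (m + 1) => Y (e k) - γ * ((k : ℕ) : ℝ)) := by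
    rw [Fin.monotone_iff_le_succ]
    intro i
    have h1 : Y (e i.castSucc) ≤ Y (e i.succ) := hmono (Fin.castSucc_lt_succ).le
    have h2 := h' (e i.succ) (e i.castSucc)
      (fun hh => (Fin.castSucc_lt_succ (i := i)).ne' (e.injective hh))
    have h3 := lt_of_pow_lt_pow_left₀ 2 (by linarith) h2
    simp only [Fin.val_castSucc, Fin.val_succ]
    push_cast
    linarith
  have hpair : ∀ i j : Fin (m + 1),
      γ ^ 4 * (((i : ℕ) : ℝ) - ((j : ℕ) : ℝ)) ^ 4 ≤ (Y (e i) - Y (e j)) ^ 4 := by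
    have key : ∀ i j : Fin (m + 1), i ≤ j →
        γ ^ 4 * (((j : ℕ) : ℝ) - ((i : ℕ) : ℝ)) ^ 4 ≤ (Y (e j) - Y (e i)) ^ 4 := by
      intro i j hij
      have h1 := hf hij
      simp only at h1
      have h2 : ((i : ℕ) : ℝ) ≤ ((j : ℕ) : ℝ) := by exact_mod_cast hij
      rw [← mul_pow]
      exact pow_le_pow_left₀ (mul_nonneg hγ.le (by linarith)) (by linarith) 4
    intro i j
    rcases le_total i j with hij | hij
    · have := key i j hij
      rw [show (((i : ℕ) : ℝ) - ((j : ℕ) : ℝ)) ^ 4 = (((j : ℕ) : ℝ) - ((i : ℕ) : ℝ)) ^ 4 by ring,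
        show (Y (e i) - Y (e j)) ^ 4 = (Y (e j) - Y (e i)) ^ 4 by ring]
      exact this
    · exact key j i hij
  have h8 : ∀ a b : ℝ, (a - b) ^ 4 ≤ 8 * a ^ 4 + 8 * b ^ 4 := by
    intro a b
    have e1 : (a - b) ^ 2 ≤ 2 * (a ^ 2 + b ^ 2) := by nlinarith [sq_nonneg (a + b)]
    have e2 : ((a - b) ^ 2) ^ 2 ≤ (2 * (a ^ 2 + b ^ 2)) ^ 2 := pow_le_pow_left₀ (sq_nonneg _) e1 2
    nlinarith [sq_nonneg (a ^ 2 - b ^ 2)]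
  calc γ ^ 4 * ∑ i : Fin (m + 1), ∑ j : Fin (m + 1), (((i : ℕ) : ℝ) - ((j : ℕ) : ℝ)) ^ 4
      = ∑ i : Fin (m + 1), ∑ j : Fin (m + 1),
          γ ^ 4 * (((i : ℕ) : ℝ) - ((j : ℕ) : ℝ)) ^ 4 := by simp_rw [Finset.mul_sum]
    _ ≤ ∑ i : Fin (m + 1), ∑ j : Fin (m + 1), (8 * Y (e i) ^ 4 + 8 * Y (e j) ^ 4) :=
        Finset.sum_le_sum fun i _ => Finset.sum_le_sum fun j _ => (hpair i j).trans (h8 _ _)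
    _ = 16 * ((m + 1 : ℕ) : ℝ) * ∑ i, Y (e i) ^ 4 := by
        simp only [Finset.sum_add_distrib, Finset.sum_const, Finset.card_univ, Fintype.card_fin,
          nsmul_eq_mul, ← Finset.mul_sum]
        ring
    _ = _ := by rw [Equiv.sum_comp e (fun i => Y i ^ 4)]

/-- **Lemma 9.**  Let `x_1, …, x_n` be iid `N(0, I_d)` with `n ≥ 5`, `β* ≠ 0`, and for
`γ > 0` let `A_γ = {min_{i<j} (x_iᵀβ* - x_jᵀβ*)² ≤ γ²}`.
If `‖β*‖₂² ≤ (1/(25π)) n² γ²` then `P(A_γ) ≥ 0.85`. -/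
theorem gap_event_lower (n d : ℕ) (hn : 5 ≤ n) (βs : Fin d → ℝ) (hβ : βs ≠ 0) (γ : ℝ)
    (hγ : 0 < γ)
    (hsnr : l2 βs ^ 2 ≤ (1 / (25 * Real.pi)) * (n : ℝ) ^ 2 * γ ^ 2) :
    μX n d {x | ∃ i j : Fin n, i < j ∧
        ((∑ l, x i l * βs l) - ∑ l, x j l * βs l) ^ 2 ≤ γ ^ 2}
      ≥ ENNReal.ofReal 0.85 := by
  obtain ⟨m, rfl⟩ : ∃ m, n = m + 1 := ⟨n - 1, by omega⟩
  set N : ℝ := ((m + 1 : ℕ) : ℝ) with hN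
  have hN5 : (5 : ℝ) ≤ N := by rw [hN]; exact_mod_cast hn
  set s : ℝ := ∑ l, βs l ^ 2 with hs
  have hs0 : 0 ≤ s := Finset.sum_nonneg fun _ _ => sq_nonneg _
  have hl2 : l2 βs ^ 2 = s := Real.sq_sqrt hs0
  rw [hl2] at hsnr
  set A : Set (Fin (m + 1) → Fin d → ℝ) := {x | ∃ i j : Fin (m + 1), i < j ∧
        ((∑ l, x i l * βs l) - ∑ l, x j l * βs l) ^ 2 ≤ γ ^ 2} with hA
  have hAm : MeasurableSet A := by
    have : A = ⋃ i : Fin (m + 1), ⋃ j : Fin (m + 1), ⋃ _ : i < j,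
        {x | ((∑ l, x i l * βs l) - ∑ l, x j l * βs l) ^ 2 ≤ γ ^ 2} := by
      ext x; simp [hA]
    rw [this]
    refine MeasurableSet.iUnion fun i => MeasurableSet.iUnion fun j => MeasurableSet.iUnion fun _ =>
      measurableSet_le (by fun_prop) (by fun_prop)
  set F : (Fin (m + 1) → Fin d → ℝ) → ℝ := fun x => ∑ i, (∑ l, x i l * βs l) ^ 4 with hF
  have hp : ∀ i : Fin (m + 1), MeasurePreserving (Function.eval i) (μX (m + 1) d)
      (Measure.pi fun _ => stdGaussian) := fun i =>
    measurePreserving_eval (fun _ : Fin (m + 1) => Measure.pi fun _ : Fin d => stdGaussian) i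
  obtain ⟨hint, hmom⟩ := aux_moment βs
  have hFi : ∀ i : Fin (m + 1), Integrable (fun x : Fin (m + 1) → Fin d → ℝ =>
      (∑ l, x i l * βs l) ^ 4) (μX (m + 1) d) := fun i =>
    (hp i).integrable_comp_of_integrable hint
  have hFe : ∀ i : Fin (m + 1), ∫ x : Fin (m + 1) → Fin d → ℝ,
      (∑ l, x i l * βs l) ^ 4 ∂(μX (m + 1) d) = 3 * s ^ 2 := by
    intro i
    rw [hs, ← hmom, ← (hp i).map_eq, integral_map (hp i).measurable.aemeasurable
      (by rw [(hp i).map_eq]; exact hint.aestronglyMeasurable)]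
  have hFint : Integrable F (μX (m + 1) d) := integrable_finsetSum _ fun i _ => hFi i
  have hFval : ∫ x, F x ∂(μX (m + 1) d) = N * (3 * s ^ 2) := by
    rw [hF, integral_finsetSum _ fun i _ => hFi i]
    simp only [hFe, Finset.sum_const, Finset.card_univ, Fintype.card_fin, nsmul_eq_mul, hN]
  set ε : ℝ := γ ^ 4 * (N * (N ^ 2 - 1) * (2 * N ^ 2 - 3)) / 480 with hε
  have hε0 : 0 < ε := by
    have : 0 < N * (N ^ 2 - 1) * (2 * N ^ 2 - 3) :=
      mul_pos (mul_pos (by linarith) (by nlinarith)) (by nlinarith)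
    positivity
  have hsub : Aᶜ ⊆ {x | ε ≤ F x} := by
    intro x hx
    have hx' : ∀ i j : Fin (m + 1), i < j →
        γ ^ 2 < ((∑ l, x i l * βs l) - ∑ l, x j l * βs l) ^ 2 := by
      intro i j hij
      by_contra hc
      exact hx ⟨i, j, hij, not_lt.mp hc⟩
    have h1 := aux_gap m (fun i => ∑ l, x i l * βs l) γ hγ hx'
    rw [aux_sum, ← hN] at h1
    change ε ≤ F x
    have h2 : 16 * N * ε ≤ 16 * N * F x := by
      refine le_trans (le_of_eq ?_) h1
      rw [hε]; ring
    exact le_of_mul_le_mul_left h2 (by linarith)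
  have hmark := mul_meas_ge_le_integral_of_nonneg (μ := μX (m + 1) d) (f := F)
    (Filter.Eventually.of_forall fun x => Finset.sum_nonneg fun i _ => by positivity) hFint ε
  rw [hFval] at hmark
  have hpi : (9 : ℝ) ≤ Real.pi ^ 2 := by nlinarith [Real.pi_gt_three]
  have hs2 : s ^ 2 ≤ N ^ 4 * γ ^ 4 / 5625 := by
    have h1 : s ^ 2 ≤ ((1 / (25 * Real.pi)) * N ^ 2 * γ ^ 2) ^ 2 := pow_le_pow_left₀ hs0 hsnr 2
    have h2 : ((1 / (25 * Real.pi)) * N ^ 2 * γ ^ 2) ^ 2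
        = N ^ 4 * γ ^ 4 / (625 * Real.pi ^ 2) := by
      field_simp; ring
    rw [h2] at h1
    refine h1.trans ?_
    exact div_le_div_of_nonneg_left (by positivity) (by norm_num) (by linarith)
  have hbound : N * (3 * s ^ 2) ≤ ε * 0.15 := by
    have h1 : 0 ≤ γ ^ 4 * N := by positivity
    have h2 : 3 * N ^ 4 / 5625 ≤ 0.15 * ((N ^ 2 - 1) * (2 * N ^ 2 - 3)) / 480 := by
      nlinarith [mul_nonneg (sq_nonneg N) (by nlinarith : (0 : ℝ) ≤ N ^ 2 - 25)]
    calc N * (3 * s ^ 2) ≤ N * (3 * (N ^ 4 * γ ^ 4 / 5625)) := by gcongr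
      _ = γ ^ 4 * N * (3 * N ^ 4 / 5625) := by ring
      _ ≤ γ ^ 4 * N * (0.15 * ((N ^ 2 - 1) * (2 * N ^ 2 - 3)) / 480) :=
          mul_le_mul_of_nonneg_left h2 h1
      _ = ε * 0.15 := by rw [hε]; ring
  have hbad : (μX (m + 1) d).real Aᶜ ≤ 0.15 := by
    have h1 : (μX (m + 1) d).real Aᶜ ≤ (μX (m + 1) d).real {x | ε ≤ F x} := measureReal_mono hsub
    refine h1.trans (le_of_mul_le_mul_left (hmark.trans hbound) hε0)
  rw [probReal_compl_eq_one_sub hAm] at hbad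
  rw [ge_iff_le, ENNReal.ofReal_le_iff_le_toReal (measure_ne_top _ _)]
  change 0.85 ≤ (μX (m + 1) d).real A
  norm_num at hbad ⊢
  linarith

end
end
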